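/- arXiv:2205.03470 — 4 statements merged into one kernel-verified Lean document; each statement's English description precedes it below -/
import Mathlib

section
/- Let N : ℝ^d → ℝ be differentiable and 1-strongly convex, and let l : ℝ → ℝ be convex and differentiable with |l'(z)| ≤ 1 for all z. Let Λ > 0. For a training set x^train of n records (x, y) with x ∈ ℝ^d, ‖x‖₂ ≤ 1 and y ∈ [−1, 1], let p_min(x^train) be the unique minimizer of J(p) = (1/n) Σ_{(x,y)∈x^train} l(y · pᵀx) + Λ·N(p). Then for any two training sets x^train and x'^train of size n that differ in a single record, ‖p_min(x^train) − p_min(x'^train)‖₂ ≤ 2/(nΛ); that is, the L2-sensitivity of p_min is at most 2/(nΛ). -/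
open MeasureTheory
open scoped ENNReal NNReal

/-- The regularized empirical risk of the parameter vector `p` on the training set
`data` of `n` records `(x, y)`:
`J(p) = (1/n) Σ_{(x,y)∈data} l(y ⬝ ⟨p, x⟩) + Λ N(p)`. -/
noncomputable def ermObjective {d n : ℕ}
    (l : ℝ → ℝ) (Nreg : EuclideanSpace ℝ (Fin d) → ℝ) (Λ : ℝ)
    (data : Fin n → EuclideanSpace ℝ (Fin d) × ℝ)
    (p : EuclideanSpace ℝ (Fin d)) : ℝ :=
  (1 / (n : ℝ)) * ∑ i, l ((data i).2 * (inner ℝ p (data i).1 : ℝ)) + Λ * Nreg p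

lemma erm_strong {d n : ℕ}
    (Nreg : EuclideanSpace ℝ (Fin d) → ℝ)
    (hNstrong : ConvexOn ℝ Set.univ fun p => Nreg p - ‖p‖ ^ 2 / 2)
    (l : ℝ → ℝ) (hlconv : ConvexOn ℝ Set.univ l)
    (Λ : ℝ) (hΛ : 0 < Λ)
    (data : Fin n → EuclideanSpace ℝ (Fin d) × ℝ)
    (p q : EuclideanSpace ℝ (Fin d)) (a b : ℝ) (ha : 0 ≤ a) (hb : 0 ≤ b) (hab : a + b = 1) :
    ermObjective l Nreg Λ data (a • p + b • q) ≤
      a * ermObjective l Nreg Λ data p + b * ermObjective l Nreg Λ data q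
        - a * b * (Λ / 2 * ‖p - q‖ ^ 2) := by
  have hS : StrongConvexOn Set.univ 1 Nreg := by
    rw [strongConvexOn_iff_convex]
    have e : (fun x => Nreg x - 1 / (2 : ℝ) * ‖x‖ ^ 2) = fun p => Nreg p - ‖p‖ ^ 2 / 2 := by
      funext x
      ring
    rw [e]
    exact hNstrong
  have h1 := hS.2 (Set.mem_univ p) (Set.mem_univ q) ha hb hab
  simp only [smul_eq_mul] at h1
  have h2 : ∑ i, l ((data i).2 * (inner ℝ (a • p + b • q) (data i).1 : ℝ)) ≤
      a * ∑ i, l ((data i).2 * (inner ℝ p (data i).1 : ℝ)) +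
      b * ∑ i, l ((data i).2 * (inner ℝ q (data i).1 : ℝ)) := by
    rw [Finset.mul_sum, Finset.mul_sum, ← Finset.sum_add_distrib]
    refine Finset.sum_le_sum fun i _ => ?_
    have := hlconv.2 (Set.mem_univ ((data i).2 * (inner ℝ p (data i).1 : ℝ)))
      (Set.mem_univ ((data i).2 * (inner ℝ q (data i).1 : ℝ))) ha hb hab
    simp only [smul_eq_mul] at this
    convert this using 2
    rw [inner_add_left, real_inner_smul_left, real_inner_smul_left]
    ring
  have h3 := mul_le_mul_of_nonneg_left h2 (show (0:ℝ) ≤ 1 / (n:ℝ) by positivity)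
  have h4 := mul_le_mul_of_nonneg_left h1 hΛ.le
  unfold ermObjective
  linarith

lemma erm_growth {d n : ℕ}
    (Nreg : EuclideanSpace ℝ (Fin d) → ℝ)
    (hNstrong : ConvexOn ℝ Set.univ fun p => Nreg p - ‖p‖ ^ 2 / 2)
    (l : ℝ → ℝ) (hlconv : ConvexOn ℝ Set.univ l)
    (Λ : ℝ) (hΛ : 0 < Λ)
    (data : Fin n → EuclideanSpace ℝ (Fin d) × ℝ)
    (p q : EuclideanSpace ℝ (Fin d))
    (hp : ∀ q, ermObjective l Nreg Λ data p ≤ ermObjective l Nreg Λ data q) :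
    Λ / 2 * ‖p - q‖ ^ 2 ≤ ermObjective l Nreg Λ data q - ermObjective l Nreg Λ data p := by
  have key : ∀ t : ℝ, 0 < t → t ≤ 1 → (1 - t) * (Λ / 2 * ‖p - q‖ ^ 2) ≤
      ermObjective l Nreg Λ data q - ermObjective l Nreg Λ data p := by
    intro t ht ht1
    have h := erm_strong Nreg hNstrong l hlconv Λ hΛ data p q (1 - t) t (by linarith) ht.le
      (by ring)
    have h' := hp ((1 - t) • p + t • q)
    refine le_of_mul_le_mul_left ?_ ht
    linarith
  have hA := hp q
  generalize Λ / 2 * ‖p - q‖ ^ 2 = B at *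
  generalize ermObjective l Nreg Λ data q - ermObjective l Nreg Λ data p = A at *
  by_contra hcon
  push Not at hcon
  have hA0 : 0 ≤ A := by simpa using key 1 one_pos le_rfl
  have hB : 0 < B := by linarith
  have := key ((B - A) / (2 * B)) (by apply div_pos <;> linarith)
    (by rw [div_le_one (by linarith)]; linarith)
  have e : (1 - (B - A) / (2 * B)) * B = (A + B) / 2 := by
    field_simp
    ring
  linarith

lemma erm_loss_lip {d : ℕ} (l : ℝ → ℝ) (hldiff : Differentiable ℝ l)
    (hlderiv : ∀ z, |deriv l z| ≤ 1) (x : EuclideanSpace ℝ (Fin d)) (y : ℝ)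
    (hx : ‖x‖ ≤ 1) (hy : |y| ≤ 1) (p q : EuclideanSpace ℝ (Fin d)) :
    |l (y * (inner ℝ p x : ℝ)) - l (y * (inner ℝ q x : ℝ))| ≤ ‖p - q‖ := by
  have h := Convex.norm_image_sub_le_of_norm_deriv_le (f := l) (s := Set.univ) (C := 1)
    (x := y * (inner ℝ q x : ℝ)) (y := y * (inner ℝ p x : ℝ))
    (fun z _ => hldiff z) (fun z _ => hlderiv z) convex_univ trivial trivial
  rw [← mul_sub, ← inner_sub_left, one_mul, Real.norm_eq_abs, Real.norm_eq_abs, abs_mul] at h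
  have h2 := abs_real_inner_le_norm (p - q) x
  have h3 : ‖p - q‖ * ‖x‖ ≤ ‖p - q‖ := mul_le_of_le_one_right (norm_nonneg _) hx
  have h4 := mul_le_of_le_one_left (abs_nonneg (inner ℝ (p - q) x : ℝ)) hy
  linarith

/-- for a differentiable 1-strongly convex regularizer `N`, a convex
differentiable loss `l` with `|l'| ≤ 1`, and two size-`n` training sets (with
`‖x‖₂ ≤ 1` and `y ∈ [−1,1]`) differing in a single record, the minimizers of the two
regularized empirical risks are at distance at most `2/(nΛ)`; i.e., the
L2-sensitivity of `p_min` is at most `2/(nΛ)`. -/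
theorem erm_sensitivity {d n : ℕ} (hn : 0 < n)
    (Nreg : EuclideanSpace ℝ (Fin d) → ℝ)
    (hNdiff : Differentiable ℝ Nreg)
    (hNstrong : ConvexOn ℝ Set.univ fun p => Nreg p - ‖p‖ ^ 2 / 2)
    (l : ℝ → ℝ) (hlconv : ConvexOn ℝ Set.univ l) (hldiff : Differentiable ℝ l)
    (hlderiv : ∀ z, |deriv l z| ≤ 1)
    (Λ : ℝ) (hΛ : 0 < Λ)
    (data data' : Fin n → EuclideanSpace ℝ (Fin d) × ℝ)
    (hdx : ∀ i, ‖(data i).1‖ ≤ 1) (hdx' : ∀ i, ‖(data' i).1‖ ≤ 1)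
    (hdy : ∀ i, |(data i).2| ≤ 1) (hdy' : ∀ i, |(data' i).2| ≤ 1)
    (j : Fin n) (hneighbor : ∀ i, i ≠ j → data i = data' i)
    (p p' : EuclideanSpace ℝ (Fin d))
    (hp : ∀ q, ermObjective l Nreg Λ data p ≤ ermObjective l Nreg Λ data q)
    (hp' : ∀ q, ermObjective l Nreg Λ data' p' ≤ ermObjective l Nreg Λ data' q) :
    ‖p - p'‖ ≤ 2 / (n * Λ) := by
  have g1 := erm_growth Nreg hNstrong l hlconv Λ hΛ data p p' hp
  have g2 := erm_growth Nreg hNstrong l hlconv Λ hΛ data' p' p hp'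
  rw [norm_sub_rev p' p] at g2
  have l1 := le_of_abs_le (erm_loss_lip l hldiff hlderiv _ _ (hdx j) (hdy j) p' p)
  have l2 := le_of_abs_le (erm_loss_lip l hldiff hlderiv _ _ (hdx' j) (hdy' j) p p')
  rw [norm_sub_rev p' p] at l1
  have hsum : ∀ q, ∑ i, l ((data i).2 * (inner ℝ q (data i).1 : ℝ)) -
      ∑ i, l ((data' i).2 * (inner ℝ q (data' i).1 : ℝ)) =
      l ((data j).2 * (inner ℝ q (data j).1 : ℝ)) -
      l ((data' j).2 * (inner ℝ q (data' j).1 : ℝ)) := by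
    intro q
    rw [← Finset.sum_sub_distrib]
    refine Finset.sum_eq_single j (fun i _ hi => ?_) (by simp)
    rw [hneighbor i hi, sub_self]
  have s1 := hsum p
  have s2 := hsum p'
  have hn' : (0:ℝ) < n := by exact_mod_cast hn
  unfold ermObjective at g1 g2
  have hb : (∑ i, l ((data i).2 * (inner ℝ p' (data i).1 : ℝ)) -
      ∑ i, l ((data' i).2 * (inner ℝ p' (data' i).1 : ℝ))) -
      (∑ i, l ((data i).2 * (inner ℝ p (data i).1 : ℝ)) -
      ∑ i, l ((data' i).2 * (inner ℝ p (data' i).1 : ℝ))) ≤ 2 * ‖p - p'‖ := by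
    linarith
  have hb' := mul_le_mul_of_nonneg_left hb (show (0:ℝ) ≤ 1 / (n:ℝ) by positivity)
  have fin : Λ * ‖p - p'‖ ^ 2 ≤ 1 / (n:ℝ) * (2 * ‖p - p'‖) := by linarith
  rcases (norm_nonneg (p - p')).eq_or_lt with h0 | h0
  · rw [← h0]; positivity
  · rw [le_div_iff₀ (by positivity)]
    refine le_of_mul_le_mul_left ?_ h0
    have := mul_le_mul_of_nonneg_left fin hn'.le
    have e : (n:ℝ) * (1 / (n:ℝ) * (2 * ‖p - p'‖)) = 2 * ‖p - p'‖ := by field_simp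
    linarith
end

section
/- Let n ≥ 1, Λ > 0, and let p, p' ∈ ℝ^d with ‖p − p'‖₂ ≤ 2/(nΛ). Define h_p(x) = 2/(1 + exp(−pᵀx)) − 1. Then for every q ∈ ℝ^d and every x ∈ ℝ^d with ‖x‖₂ ≤ 1, |h_{p+q}(x) − h_{p'+q}(x)| ≤ 2·(exp(2/(nΛ)) − 1). -/
/-- The prediction of the logistic regression model with parameter vector `p` on the
record `x`, rescaled to the interval `[−1,1]`:
`h_p(x) = 2·h'_p(x) − 1` with `h'_p(x) = 1/(1 + exp(−⟨p,x⟩))`. -/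
noncomputable def hLog {d : ℕ} (p x : EuclideanSpace ℝ (Fin d)) : ℝ :=
  2 / (1 + Real.exp (-(inner ℝ p x : ℝ))) - 1

theorem hLog_aux (a b c : ℝ) (hc : 0 ≤ c) (h : a - b ≤ c) :
    2 / (1 + Real.exp (-a)) - 2 / (1 + Real.exp (-b)) ≤ 2 * (Real.exp c - 1) := by
  have hA := Real.exp_pos (-a)
  have hB := Real.exp_pos (-b)
  have hE : 1 ≤ Real.exp c := Real.one_le_exp hc
  have hBA : Real.exp (-b) ≤ Real.exp (-a) * Real.exp c := by
    rw [← Real.exp_add]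
    exact Real.exp_le_exp.mpr (by linarith)
  generalize Real.exp (-a) = A at *
  generalize Real.exp (-b) = B at *
  generalize Real.exp c = E at *
  rw [div_sub_div _ _ (by positivity) (by positivity), div_le_iff₀ (by positivity)]
  have h1 : 0 ≤ (E - 1) * (1 + B + A * B) :=
    mul_nonneg (by linarith) (by positivity)
  nlinarith

/-- if `‖p − p'‖₂ ≤ 2/(nΛ)` then for every `q` and every `x` with
`‖x‖₂ ≤ 1`, `|h_{p+q}(x) − h_{p'+q}(x)| ≤ 2(exp(2/(nΛ)) − 1)`. -/
theorem hLog_sensitivity {d : ℕ} (n : ℕ) (hn : 1 ≤ n) (Λ : ℝ) (hΛ : 0 < Λ)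
    (p p' : EuclideanSpace ℝ (Fin d)) (hpp' : ‖p - p'‖ ≤ 2 / (n * Λ))
    (q x : EuclideanSpace ℝ (Fin d)) (hx : ‖x‖ ≤ 1) :
    |hLog (p + q) x - hLog (p' + q) x| ≤ 2 * (Real.exp (2 / (n * Λ)) - 1) := by
  have hc : 0 ≤ 2 / ((n : ℝ) * Λ) := by positivity
  have hin : |inner ℝ (p - p') x| ≤ 2 / ((n : ℝ) * Λ) := by
    have h1 := abs_real_inner_le_norm (p - p') x
    have h2 := mul_le_mul_of_nonneg_left hx (norm_nonneg (p - p'))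
    linarith
  rw [inner_sub_left, abs_le] at hin
  have hab := hLog_aux (inner ℝ (p + q) x) (inner ℝ (p' + q) x) _ hc
    (by rw [inner_add_left, inner_add_left]; linarith [hin.2])
  have hba := hLog_aux (inner ℝ (p' + q) x) (inner ℝ (p + q) x) _ hc
    (by rw [inner_add_left, inner_add_left]; linarith [hin.1])
  unfold hLog
  rw [abs_le]
  constructor <;> linarith
end

section
/- Let ε_1, ε_2 > 0 and Λ > 0. Let Q be a random vector on ℝ^d with density proportional to exp(−(n^train·Λ·ε_1/2)·‖q‖₂), let a = max(2/n^test, 2·(exp(2/(n^train·Λ)) − 1)), and let R be an independent real random variable distributed according to Lap(a/ε_2). Fix a test set x^test of n^test records (x, y) with ‖x‖₂ ≤ 1 and y ∈ [−1,1]. Then the mechanism g_1(x^train) = s(p_min(x^train) + Q, x^test) + R is ε_2-differentially private with respect to neighboring training sets of size n^train. -/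
open MeasureTheory
open scoped ENNReal NNReal

/-- The centered Laplace distribution with scale `b`,
with density `z ↦ (1/(2b)) exp(−|z|/b)` w.r.t. Lebesgue measure. -/
noncomputable def laplace (b : ℝ) : Measure ℝ :=
  volume.withDensity fun z => ENNReal.ofReal ((2 * b)⁻¹ * Real.exp (-|z| / b))

/-- The (unnormalized) density of the output-perturbation noise vector `Q`:
proportional to `exp(−(n Λ ε₁ / 2) ‖q‖₂)`. -/
noncomputable def pertDensity {d : ℕ} (n : ℕ) (Λ ε₁ : ℝ)
    (q : EuclideanSpace ℝ (Fin d)) : ℝ≥0∞ :=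
  ENNReal.ofReal (Real.exp (-((n : ℝ) * Λ * ε₁ / 2) * ‖q‖))

/-- The distribution of the output-perturbation noise vector `Q` on `ℝ^d`, with
density proportional to `exp(−(n Λ ε₁ / 2) ‖q‖₂)`. -/
noncomputable def pertMeasure (d n : ℕ) (Λ ε₁ : ℝ) :
    Measure (EuclideanSpace ℝ (Fin d)) :=
  (∫⁻ q : EuclideanSpace ℝ (Fin d), pertDensity n Λ ε₁ q)⁻¹ • volume.withDensity (pertDensity n Λ ε₁)

/-- The error function: the mean absolute error
`s(p, test) = (1/n_test) Σ_{(x,y)∈test} |h_p(x) − y|` of the logistic regression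
model `p` on the test set. -/
noncomputable def errS {d m : ℕ} (p : EuclideanSpace ℝ (Fin d))
    (test : Fin m → EuclideanSpace ℝ (Fin d) × ℝ) : ℝ :=
  (1 / (m : ℝ)) * ∑ i, |hLog p (test i).1 - (test i).2|

/-- The regularized logistic regression objective
`(1/n) Σ_{(x,y)} ln(1 + e^{−y⟨p,x⟩}) + (Λ/2)‖p‖₂²`. -/
noncomputable def logRegObjective {d n : ℕ} (Λ : ℝ)
    (data : Fin n → EuclideanSpace ℝ (Fin d) × ℝ)
    (p : EuclideanSpace ℝ (Fin d)) : ℝ :=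
  (1 / (n : ℝ)) * ∑ i, Real.log (1 + Real.exp (-((data i).2 * (inner ℝ p (data i).1 : ℝ))))
    + Λ * (‖p‖ ^ 2 / 2)

/-- The mechanism `g₁`: given the exact minimizer `p₀ = p_min(x^train)`, release
`s(p₀ + Q, x^test) + R` with `Q ∼ pertMeasure` and an independent `R ∼ Lap(a/ε₂)`. -/
noncomputable def g1 {d ntest : ℕ} (ntrain : ℕ) (Λ ε₁ ε₂ a : ℝ)
    (p₀ : EuclideanSpace ℝ (Fin d))
    (test : Fin ntest → EuclideanSpace ℝ (Fin d) × ℝ) : Measure ℝ :=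
  Measure.map (fun qr : EuclideanSpace ℝ (Fin d) × ℝ => errS (p₀ + qr.1) test + qr.2)
    ((pertMeasure d ntrain Λ ε₁).prod (laplace (a / ε₂)))

theorem aux_mid (u v : ℝ) : Real.log (1 + Real.exp ((u + v) / 2)) ≤
    (Real.log (1 + Real.exp u) + Real.log (1 + Real.exp v)) / 2 := by
  have hu := Real.exp_pos (u / 2)
  have hv := Real.exp_pos (v / 2)
  have e1 : Real.exp ((u + v) / 2) = Real.exp (u / 2) * Real.exp (v / 2) := by
    rw [← Real.exp_add]; congr 1; ring
  have e2 : Real.exp u = Real.exp (u / 2) * Real.exp (u / 2) := by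
    rw [← Real.exp_add]; congr 1; ring
  have e3 : Real.exp v = Real.exp (v / 2) * Real.exp (v / 2) := by
    rw [← Real.exp_add]; congr 1; ring
  rw [e1, e2, e3]
  generalize Real.exp (u / 2) = x at *
  generalize Real.exp (v / 2) = y at *
  have h : Real.log ((1 + x * y) * (1 + x * y)) ≤ Real.log ((1 + x * x) * (1 + y * y)) := by
    apply Real.log_le_log (by positivity)
    nlinarith [sq_nonneg (x - y)]
  rw [Real.log_mul (by positivity) (by positivity),
    Real.log_mul (by positivity) (by positivity)] at h
  linarith

theorem aux_lip (u v : ℝ) : Real.log (1 + Real.exp u) - Real.log (1 + Real.exp v) ≤ |u - v| := by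
  have hv := Real.exp_pos v
  have h : Real.log (1 + Real.exp u) ≤ Real.log (Real.exp |u - v| * (1 + Real.exp v)) := by
    apply Real.log_le_log (by positivity)
    have h1 : 1 ≤ Real.exp |u - v| := Real.one_le_exp (abs_nonneg _)
    have h2 : Real.exp u ≤ Real.exp |u - v| * Real.exp v := by
      rw [← Real.exp_add]
      apply Real.exp_le_exp.2
      linarith [le_abs_self (u - v)]
    nlinarith
  rw [Real.log_mul (by positivity) (by positivity), Real.log_exp] at h
  linarith

theorem aux_h (u v : ℝ) :
    |(2 / (1 + Real.exp (-u)) - 1) - (2 / (1 + Real.exp (-v)) - 1)| ≤ |u - v| := by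
  have hd : ∀ x ∈ (Set.univ : Set ℝ), HasDerivWithinAt
      (fun u : ℝ => 2 / (1 + Real.exp (-u)) - 1)
      (2 * Real.exp (-x) / (1 + Real.exp (-x)) ^ 2) Set.univ x := by
    intro x _
    have hx := Real.exp_pos (-x)
    have h1 : HasDerivAt (fun u : ℝ => 1 + Real.exp (-u)) (-Real.exp (-x)) x := by
      have := ((hasDerivAt_id x).neg.exp).const_add 1
      simpa using this
    have h2 := ((hasDerivAt_const x (2 : ℝ)).div h1 (by positivity)).sub_const 1
    apply HasDerivAt.hasDerivWithinAt
    refine HasDerivAt.congr_deriv h2 ?_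
    ring
  have := Convex.norm_image_sub_le_of_norm_hasDerivWithin_le (C := 1) hd (by
    intro x _
    have hx := Real.exp_pos (-x)
    rw [Real.norm_of_nonneg (by positivity), div_le_one (by positivity)]
    nlinarith) convex_univ (Set.mem_univ v) (Set.mem_univ u)
  simpa [Real.norm_eq_abs] using this

theorem aux_strong {d n : ℕ} (Λ : ℝ)
    (data : Fin n → EuclideanSpace ℝ (Fin d) × ℝ) (p p' : EuclideanSpace ℝ (Fin d))
    (hp : ∀ q, logRegObjective Λ data p ≤ logRegObjective Λ data q) :
    Λ / 4 * ‖p - p'‖ ^ 2 ≤ logRegObjective Λ data p' - logRegObjective Λ data p := by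
  have h := hp ((1 / 2 : ℝ) • (p + p'))
  have hpar := parallelogram_law_with_norm ℝ p p'
  have hn : ‖(1 / 2 : ℝ) • (p + p')‖ ^ 2 = ‖p + p'‖ ^ 2 / 4 := by
    rw [norm_smul, mul_pow]; norm_num; ring
  have hs : ∑ i, Real.log (1 + Real.exp (-((data i).2 *
        (inner ℝ ((1 / 2 : ℝ) • (p + p')) (data i).1 : ℝ)))) ≤
      (∑ i, Real.log (1 + Real.exp (-((data i).2 * (inner ℝ p (data i).1 : ℝ))))
      + ∑ i, Real.log (1 + Real.exp (-((data i).2 * (inner ℝ p' (data i).1 : ℝ))))) / 2 := by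
    rw [← Finset.sum_add_distrib, Finset.sum_div]
    apply Finset.sum_le_sum
    intro i _
    refine le_trans (le_of_eq ?_) (aux_mid _ _)
    rw [real_inner_smul_left, inner_add_left]
    congr 3
    ring
  have hs' := mul_le_mul_of_nonneg_left hs (show (0 : ℝ) ≤ 1 / (n : ℝ) by positivity)
  unfold logRegObjective at h ⊢
  rw [hn] at h
  have hk : ‖p + p'‖ ^ 2 = 2 * (‖p‖ ^ 2 + ‖p'‖ ^ 2) - ‖p - p'‖ ^ 2 := by nlinarith
  rw [hk] at h
  linarith

theorem aux_inner {d : ℕ} (x : EuclideanSpace ℝ (Fin d) × ℝ) (hx : ‖x.1‖ ≤ 1)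
    (hy : |x.2| ≤ 1) (p p' : EuclideanSpace ℝ (Fin d)) :
    Real.log (1 + Real.exp (-(x.2 * (inner ℝ p x.1 : ℝ)))) -
      Real.log (1 + Real.exp (-(x.2 * (inner ℝ p' x.1 : ℝ)))) ≤ ‖p - p'‖ := by
  refine (aux_lip _ _).trans ?_
  have : -(x.2 * (inner ℝ p x.1 : ℝ)) - -(x.2 * (inner ℝ p' x.1 : ℝ)) =
      -(x.2 * (inner ℝ (p - p') x.1 : ℝ)) := by rw [inner_sub_left]; ring
  rw [this, abs_neg, abs_mul]
  have h1 := abs_real_inner_le_norm (p - p') x.1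
  have h2 : ‖p - p'‖ * ‖x.1‖ ≤ ‖p - p'‖ := mul_le_of_le_one_right (norm_nonneg _) hx
  have h3 := mul_le_of_le_one_left (abs_nonneg (inner ℝ (p - p') x.1 : ℝ)) hy
  linarith

theorem aux_stab {d n : ℕ} (hn : 0 < n) (Λ : ℝ) (hΛ : 0 < Λ)
    (train train' : Fin n → EuclideanSpace ℝ (Fin d) × ℝ)
    (htrainx : ∀ i, ‖(train i).1‖ ≤ 1) (htrainy : ∀ i, |(train i).2| ≤ 1)
    (htrainx' : ∀ i, ‖(train' i).1‖ ≤ 1) (htrainy' : ∀ i, |(train' i).2| ≤ 1)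
    (j : Fin n) (hneighbor : ∀ i, i ≠ j → train i = train' i)
    (p₀ p₀' : EuclideanSpace ℝ (Fin d))
    (hp₀ : ∀ q, logRegObjective Λ train p₀ ≤ logRegObjective Λ train q)
    (hp₀' : ∀ q, logRegObjective Λ train' p₀' ≤ logRegObjective Λ train' q) :
    ‖p₀ - p₀'‖ ≤ 4 / ((n : ℝ) * Λ) := by
  have hn' : (0 : ℝ) < n := by exact_mod_cast hn
  have h1 := aux_strong Λ train p₀ p₀' hp₀
  have h2 := aux_strong Λ train' p₀' p₀ hp₀'
  rw [norm_sub_rev p₀' p₀] at h2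
  have hsum : ∀ p, logRegObjective Λ train p - logRegObjective Λ train' p = (1 / (n : ℝ)) *
      (Real.log (1 + Real.exp (-((train j).2 * (inner ℝ p (train j).1 : ℝ)))) -
      Real.log (1 + Real.exp (-((train' j).2 * (inner ℝ p (train' j).1 : ℝ))))) := by
    intro p
    unfold logRegObjective
    rw [add_sub_add_right_eq_sub, ← mul_sub, ← Finset.sum_sub_distrib]
    congr 1
    apply Finset.sum_eq_single j
    · intro i _ hi
      rw [hneighbor i hi, sub_self]
    · simp
  have a1 := hsum p₀
  have a2 := hsum p₀'
  have b1 := aux_inner (train j) (htrainx j) (htrainy j) p₀' p₀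
  have b2 := aux_inner (train' j) (htrainx' j) (htrainy' j) p₀ p₀'
  rw [norm_sub_rev p₀' p₀] at b1
  have c := mul_le_mul_of_nonneg_left (add_le_add b1 b2) (show (0 : ℝ) ≤ 1 / (n : ℝ) by positivity)
  have key : Λ / 2 * ‖p₀ - p₀'‖ ^ 2 ≤ 1 / (n : ℝ) * (‖p₀ - p₀'‖ + ‖p₀ - p₀'‖) := by
    linarith
  rcases (norm_nonneg (p₀ - p₀')).eq_or_lt with h0 | h0
  · rw [← h0]; positivity
  · rw [le_div_iff₀ (by positivity)]
    have e : 1 / (n : ℝ) * (‖p₀ - p₀'‖ + ‖p₀ - p₀'‖) = 2 * ‖p₀ - p₀'‖ / n := by ring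
    rw [e, le_div_iff₀ hn'] at key
    have : ‖p₀ - p₀'‖ * (‖p₀ - p₀'‖ * (n * Λ)) ≤ ‖p₀ - p₀'‖ * 4 := by nlinarith
    exact le_of_mul_le_mul_left this h0

theorem aux_err {d m : ℕ} (hm : 0 < m)
    (test : Fin m → EuclideanSpace ℝ (Fin d) × ℝ)
    (htestx : ∀ i, ‖(test i).1‖ ≤ 1) (p p' : EuclideanSpace ℝ (Fin d)) :
    |errS p test - errS p' test| ≤ ‖p - p'‖ := by
  have hm' : (0 : ℝ) < m := by exact_mod_cast hm
  unfold errS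
  rw [← mul_sub, ← Finset.sum_sub_distrib, abs_mul, abs_of_nonneg (by positivity)]
  have : |∑ i, (|hLog p (test i).1 - (test i).2| - |hLog p' (test i).1 - (test i).2|)| ≤
      ∑ i : Fin m, ‖p - p'‖ := by
    refine (Finset.abs_sum_le_sum_abs _ _).trans (Finset.sum_le_sum fun i _ => ?_)
    refine (abs_abs_sub_abs_le_abs_sub _ _).trans ?_
    rw [sub_sub_sub_cancel_right]
    refine (aux_h _ _).trans ?_
    rw [← inner_sub_left]
    exact (abs_real_inner_le_norm _ _).trans
      (mul_le_of_le_one_right (norm_nonneg _) (htestx i))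
  simp only [Finset.sum_const, Finset.card_univ, Fintype.card_fin, nsmul_eq_mul] at this
  calc _ ≤ 1 / (m : ℝ) * (m * ‖p - p'‖) := by gcongr
    _ = _ := by field_simp

theorem aux_laplace (b : ℝ) (S : Set ℝ) (hS : MeasurableSet S) (c : ℝ) :
    laplace b ((fun z => c + z) ⁻¹' S) =
      ∫⁻ w in S, ENNReal.ofReal ((2 * b)⁻¹ * Real.exp (-|w - c| / b)) := by
  have hS' : MeasurableSet ((fun z => c + z) ⁻¹' S) := (measurable_const_add c) hS
  rw [laplace, withDensity_apply _ hS', ← lintegral_indicator hS', ← lintegral_indicator hS,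
    ← lintegral_sub_right_eq_self _ c]
  congr 1
  funext z
  have hz : z - c ∈ (fun z => c + z) ⁻¹' S ↔ z ∈ S := by
    rw [Set.mem_preimage, add_sub_cancel]
  by_cases h : z ∈ S
  · rw [Set.indicator_of_mem (hz.2 h), Set.indicator_of_mem h]
  · rw [Set.indicator_of_notMem (fun k => h (hz.1 k)), Set.indicator_of_notMem h]

theorem aux_shift (b ε : ℝ) (hb : 0 < b) (S : Set ℝ) (hS : MeasurableSet S) (c c' : ℝ)
    (h : |c - c'| ≤ ε * b) :
    laplace b ((fun z => c + z) ⁻¹' S) ≤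
      ENNReal.ofReal (Real.exp ε) * laplace b ((fun z => c' + z) ⁻¹' S) := by
  rw [aux_laplace b S hS, aux_laplace b S hS, ← lintegral_const_mul' _ _ ENNReal.ofReal_ne_top]
  refine lintegral_mono fun w => ?_
  rw [← ENNReal.ofReal_mul (Real.exp_pos _).le]
  apply ENNReal.ofReal_le_ofReal
  rw [mul_left_comm, ← Real.exp_add]
  apply mul_le_mul_of_nonneg_left _ (by positivity)
  apply Real.exp_le_exp.2
  have e : ε + -|w - c'| / b = (ε * b - |w - c'|) / b := by field_simp; ring
  rw [e]
  apply div_le_div_of_nonneg_right _ hb.le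
  have := abs_sub_le w c c'
  linarith

theorem aux_cont {d m : ℕ} (test : Fin m → EuclideanSpace ℝ (Fin d) × ℝ) :
    Continuous fun p : EuclideanSpace ℝ (Fin d) => errS p test := by
  unfold errS hLog
  refine continuous_const.mul (continuous_finsetSum _ fun i _ => ?_)
  refine ((((continuous_const.div ?_ fun p => ?_).sub continuous_const).sub
    continuous_const)).abs
  · fun_prop
  · have := Real.exp_pos (-(inner ℝ p (test i).1 : ℝ))
    positivity

theorem aux_g1 {d ntest : ℕ} (ntrain : ℕ) (Λ ε₁ ε₂ a : ℝ)
    (p₀ : EuclideanSpace ℝ (Fin d))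
    (test : Fin ntest → EuclideanSpace ℝ (Fin d) × ℝ) (S : Set ℝ) (hS : MeasurableSet S) :
    g1 ntrain Λ ε₁ ε₂ a p₀ test S = ∫⁻ q, laplace (a / ε₂)
      ((fun z => errS (p₀ + q) test + z) ⁻¹' S) ∂(pertMeasure d ntrain Λ ε₁) := by
  have hm : Measurable (fun qr : EuclideanSpace ℝ (Fin d) × ℝ =>
      errS (p₀ + qr.1) test + qr.2) := by
    have := aux_cont test
    exact (by fun_prop : Continuous _).measurable
  haveI : SFinite (laplace (a / ε₂)) := by unfold laplace; infer_instance
  rw [g1, Measure.map_apply hm hS, Measure.prod_apply (hm hS)]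
  rfl

/-- with `a = max(2/n^test, 2(exp(2/(n^train Λ)) − 1))`, the mechanism
`g₁(x^train) = s(p_min(x^train) + Q, x^test) + R` is `ε₂`-differentially private
w.r.t. neighboring training sets of size `n^train` (differing in a single record,
with `‖x‖₂ ≤ 1` and `y ∈ [−1,1]`). -/
theorem g1_dp {d ntrain ntest : ℕ} (hntrain : 0 < ntrain) (hntest : 0 < ntest)
    (Λ ε₁ ε₂ : ℝ) (hΛ : 0 < Λ) (hε₁ : 0 < ε₁) (hε₂ : 0 < ε₂)
    (a : ℝ) (ha : a = max (2 / (ntest : ℝ))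
      (2 * (Real.exp (2 / ((ntrain : ℝ) * Λ)) - 1)))
    (test : Fin ntest → EuclideanSpace ℝ (Fin d) × ℝ)
    (htestx : ∀ i, ‖(test i).1‖ ≤ 1) (htesty : ∀ i, |(test i).2| ≤ 1)
    (train train' : Fin ntrain → EuclideanSpace ℝ (Fin d) × ℝ)
    (htrainx : ∀ i, ‖(train i).1‖ ≤ 1) (htrainy : ∀ i, |(train i).2| ≤ 1)
    (htrainx' : ∀ i, ‖(train' i).1‖ ≤ 1) (htrainy' : ∀ i, |(train' i).2| ≤ 1)
    (j : Fin ntrain) (hneighbor : ∀ i, i ≠ j → train i = train' i)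
    (p₀ p₀' : EuclideanSpace ℝ (Fin d))
    (hp₀ : ∀ q, logRegObjective Λ train p₀ ≤ logRegObjective Λ train q)
    (hp₀' : ∀ q, logRegObjective Λ train' p₀' ≤ logRegObjective Λ train' q)
    (S : Set ℝ) (hS : MeasurableSet S) :
    g1 ntrain Λ ε₁ ε₂ a p₀ test S ≤
      ENNReal.ofReal (Real.exp ε₂) * g1 ntrain Λ ε₁ ε₂ a p₀' test S := by
  rw [aux_g1 _ _ _ _ _ _ _ _ hS, aux_g1 _ _ _ _ _ _ _ _ hS,
    ← lintegral_const_mul' _ _ ENNReal.ofReal_ne_top]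
  have hn' : (0 : ℝ) < ntrain := by exact_mod_cast hntrain
  have hm' : (0 : ℝ) < ntest := by exact_mod_cast hntest
  have ha0 : 0 < a := by
    rw [ha]; exact lt_max_of_lt_left (by positivity)
  refine lintegral_mono fun q => aux_shift _ _ (by positivity) S hS _ _ ?_
  have e : ε₂ * (a / ε₂) = a := by field_simp
  rw [e]
  refine (aux_err hntest test htestx _ _).trans ?_
  rw [add_sub_add_right_eq_sub]
  refine (aux_stab hntrain Λ hΛ train train' htrainx htrainy htrainx' htrainy' j hneighbor
    p₀ p₀' hp₀ hp₀').trans ?_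
  rw [ha]
  refine le_trans ?_ (le_max_right _ _)
  have := Real.add_one_le_exp (2 / ((ntrain : ℝ) * Λ))
  have e2 : 4 / ((ntrain : ℝ) * Λ) = 2 * (2 / ((ntrain : ℝ) * Λ)) := by ring
  rw [e2]
  linarith
end

section
/- Let ε_1, ε_2 > 0, Λ > 0, t ∈ ℝ, and a = max(2/n^test, 2·(exp(2/(n^train·Λ)) − 1)). Let LogRegTest(x^train, x^test, ε_1, ε_2, Λ, t) be the mechanism that computes p̃ = p_min(x^train) + Q, where Q has density proportional to exp(−(n^train·Λ·ε_1/2)·‖q‖₂), samples r ∼ Lap(a/ε_2) independently, and returns p̃ if s(p̃, x^test) + r ≤ t and otherwise returns ⊥. Then LogRegTest is ({ℝ^d, {⊥}}, E, 0)-output differentially private with E(ℝ^d) = max(ε_1, (2/n^test)/a · ε_2) and E({⊥}) = min(E(ℝ^d), ε_2), with respect to a change of a single record in either x^train or x^test. -/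
open MeasureTheory
open scoped ENNReal NNReal Classical

/-- The σ-algebra on `Option α`: a set is measurable iff its preimage under `some`
is measurable (in particular `{none}` is measurable). -/
instance optionMeasurableSpace {α : Type*} [m : MeasurableSpace α] :
    MeasurableSpace (Option α) := m.map some

/-- `LogRegTest(x^train, x^test, ε₁, ε₂, Λ, t)`: compute `p̃ = p_min(x^train) + Q`
(with `p₀ = p_min(x^train)` given, `Q ∼ pertMeasure`), sample `r ∼ Lap(a/ε₂)`
independently, and return `p̃` if `s(p̃, x^test) + r ≤ t`, and `⊥ = none` otherwise. -/
noncomputable def logRegTest {d ntest : ℕ} (ntrain : ℕ) (Λ ε₁ ε₂ a t : ℝ)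
    (p₀ : EuclideanSpace ℝ (Fin d))
    (test : Fin ntest → EuclideanSpace ℝ (Fin d) × ℝ) :
    Measure (Option (EuclideanSpace ℝ (Fin d))) :=
  Measure.map (fun qr : EuclideanSpace ℝ (Fin d) × ℝ =>
      if errS (p₀ + qr.1) test + qr.2 ≤ t then some (p₀ + qr.1) else none)
    ((pertMeasure d ntrain Λ ε₁).prod (laplace (a / ε₂)))


/-- Density-ratio bound gives a shift bound on measures. -/
lemma aux_shift_s19 {E : Type*} [NormedAddCommGroup E] [MeasurableSpace E] [BorelSpace E]
    [SecondCountableTopology E]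
    (m : Measure E) [m.IsAddRightInvariant] (f : E → ℝ≥0∞)
    (v : E) (K : ℝ≥0∞) (hK : K ≠ ∞) (h : ∀ x, f (x - v) ≤ K * f x) :
    Measure.map (fun x => x + v) (m.withDensity f) ≤ K • m.withDensity f := by
  refine Measure.le_iff.2 fun A hA => ?_
  have hm : Measurable (fun x : E => x + v) := measurable_id.add_const v
  rw [Measure.map_apply hm hA, Measure.smul_apply, smul_eq_mul,
    withDensity_apply _ (hm hA), withDensity_apply _ hA]
  rw [← lintegral_indicator (hm hA), ← lintegral_indicator hA]
  have h1 : ∀ x, ((fun x : E => x + v) ⁻¹' A).indicator f x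
      = (fun y => A.indicator (fun y => f (y - v)) y) (x + v) := by
    intro x
    simp [Set.indicator]
  rw [lintegral_congr h1, lintegral_add_right_eq_self (μ := m)
    (fun y => A.indicator (fun y => f (y - v)) y) v]
  rw [← lintegral_const_mul' _ _ hK]
  refine lintegral_mono fun y => ?_
  by_cases hy : y ∈ A <;> simp [hy, h]

lemma aux_laplace_shift (b : ℝ) (hb : 0 < b) (v Δ : ℝ) (hv : |v| ≤ Δ) :
    Measure.map (fun x => x + v) (laplace b) ≤ ENNReal.ofReal (Real.exp (Δ / b)) • laplace b := by
  unfold laplace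
  refine aux_shift_s19 _ _ _ _ ENNReal.ofReal_ne_top fun x => ?_
  rw [← ENNReal.ofReal_mul (Real.exp_pos _).le]
  refine ENNReal.ofReal_le_ofReal ?_
  have h1 : Real.exp (-|x - v| / b) ≤ Real.exp (Δ / b) * Real.exp (-|x| / b) := by
    rw [← Real.exp_add, ← add_div]
    refine Real.exp_le_exp.2 ?_
    gcongr
    have := abs_sub_abs_le_abs_sub x (x - v)
    rw [sub_sub_cancel] at this
    linarith
  have h2 : 0 ≤ (2 * b)⁻¹ := by positivity
  nlinarith [mul_le_mul_of_nonneg_left h1 h2]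

lemma aux_pert_shift {d : ℕ} (n : ℕ) (Λ ε₁ : ℝ) (hn : 0 < n) (hΛ : 0 < Λ) (hε : 0 < ε₁)
    (v : EuclideanSpace ℝ (Fin d)) (hv : ‖v‖ ≤ 2 / (n * Λ)) :
    Measure.map (fun x => x + v) (pertMeasure d n Λ ε₁) ≤
      ENNReal.ofReal (Real.exp ε₁) • pertMeasure d n Λ ε₁ := by
  have hn' : (0 : ℝ) < n := by exact_mod_cast hn
  have key := aux_shift_s19 (volume : Measure (EuclideanSpace ℝ (Fin d)))
    (pertDensity n Λ ε₁) v (ENNReal.ofReal (Real.exp ε₁)) ENNReal.ofReal_ne_top ?_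
  · unfold pertMeasure
    rw [Measure.map_smul, smul_comm]
    exact Measure.le_iff.2 fun A hA => by
      simp only [Measure.smul_apply, smul_eq_mul]
      exact mul_le_mul_right (by simpa using key A) _
  · intro x
    unfold pertDensity
    rw [← ENNReal.ofReal_mul (Real.exp_pos _).le, ← Real.exp_add]
    refine ENNReal.ofReal_le_ofReal (Real.exp_le_exp.2 ?_)
    have h1 : ‖x‖ ≤ ‖x - v‖ + ‖v‖ := by
      simpa using norm_add_le (x - v) v
    have hc : 0 < (n : ℝ) * Λ * ε₁ / 2 := by positivity
    have h2 : ((n : ℝ) * Λ * ε₁ / 2) * ‖v‖ ≤ ε₁ := by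
      calc _ ≤ ((n : ℝ) * Λ * ε₁ / 2) * (2 / (n * Λ)) := by gcongr
        _ = ε₁ := by field_simp
    nlinarith

lemma aux_meas_some {d m : ℕ} (t : ℝ) (p₀ : EuclideanSpace ℝ (Fin d))
    (test : Fin m → EuclideanSpace ℝ (Fin d) × ℝ) :
    Measurable (fun qr : EuclideanSpace ℝ (Fin d) × ℝ =>
      if errS (p₀ + qr.1) test + qr.2 ≤ t then some (p₀ + qr.1) else none) := by
  have hs : Measurable (some : EuclideanSpace ℝ (Fin d) → Option (EuclideanSpace ℝ (Fin d))) :=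
    fun s hs => hs
  have he : Measurable (fun qr : EuclideanSpace ℝ (Fin d) × ℝ =>
      errS (p₀ + qr.1) test + qr.2) := by
    unfold errS hLog
    refine Continuous.measurable ?_
    refine Continuous.add ?_ continuous_snd
    refine continuous_const.mul (continuous_finsetSum _ fun i _ => ?_)
    refine (((continuous_const.div ?_ ?_).sub continuous_const).sub continuous_const).abs
    · fun_prop
    · intro x; positivity
  refine Measurable.ite (measurableSet_le he measurable_const) ?_ measurable_const
  exact hs.comp (by fun_prop)

lemma aux_apply {d m : ℕ} (n : ℕ) (Λ ε₁ ε₂ a t : ℝ) (p₀ : EuclideanSpace ℝ (Fin d))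
    (test : Fin m → EuclideanSpace ℝ (Fin d) × ℝ)
    (S : Set (Option (EuclideanSpace ℝ (Fin d)))) (hS : MeasurableSet S) :
    logRegTest n Λ ε₁ ε₂ a t p₀ test S =
      ∫⁻ q, laplace (a / ε₂) {r : ℝ | (if errS (p₀ + q) test + r ≤ t then some (p₀ + q) else none) ∈ S}
        ∂(pertMeasure d n Λ ε₁) := by
  unfold logRegTest
  haveI : SFinite (laplace (a / ε₂)) := by unfold laplace; infer_instance
  rw [Measure.map_apply (aux_meas_some t p₀ test) hS,
    Measure.prod_apply (aux_meas_some t p₀ test hS)]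
  rfl

/-- Change of the noisy score only. -/
lemma aux_score {d m : ℕ} (n : ℕ) (Λ ε₁ ε₂ a t Δ : ℝ) (ha : 0 < a) (hε₂ : 0 < ε₂)
    (p₀ p₀' : EuclideanSpace ℝ (Fin d))
    (test test' : Fin m → EuclideanSpace ℝ (Fin d) × ℝ)
    (S : Set (Option (EuclideanSpace ℝ (Fin d)))) (hS : MeasurableSet S)
    (hp : p₀ = p₀' ∨ ∀ p, some p ∉ S)
    (hΔ : ∀ q, |errS (p₀ + q) test - errS (p₀' + q) test'| ≤ Δ) :
    logRegTest n Λ ε₁ ε₂ a t p₀ test S ≤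
      ENNReal.ofReal (Real.exp (Δ / a * ε₂)) * logRegTest n Λ ε₁ ε₂ a t p₀' test' S := by
  rw [aux_apply _ _ _ _ _ _ _ _ _ hS, aux_apply _ _ _ _ _ _ _ _ _ hS,
    ← lintegral_const_mul' _ _ ENNReal.ofReal_ne_top]
  refine lintegral_mono fun q => ?_
  have hm : MeasurableSet {r : ℝ | (if errS (p₀' + q) test' + r ≤ t then some (p₀' + q) else none) ∈ S} :=
    measurable_prodMk_left (aux_meas_some t p₀' test' hS)
  have h := aux_laplace_shift (a / ε₂) (by positivity)
    (errS (p₀ + q) test - errS (p₀' + q) test') Δ (hΔ q)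
    {r : ℝ | (if errS (p₀' + q) test' + r ≤ t then some (p₀' + q) else none) ∈ S}
  rw [Measure.map_apply (by fun_prop) hm, Measure.smul_apply, smul_eq_mul] at h
  have e : Δ / (a / ε₂) = Δ / a * ε₂ := by field_simp
  rw [e] at h
  refine le_trans (measure_mono ?_) h
  intro r hr
  simp only [Set.mem_preimage, Set.mem_setOf_eq] at hr ⊢
  have e2 : errS (p₀' + q) test' + (r + (errS (p₀ + q) test - errS (p₀' + q) test'))
    = errS (p₀ + q) test + r := by ring
  rw [e2]
  rcases hp with hp | hp
  · rw [← hp]; exact hr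
  · split_ifs at hr ⊢ with hc
    · exact absurd hr (hp _)
    · exact hr

/-- Change of the parameter vector only. -/
lemma aux_param {d m : ℕ} (n : ℕ) (Λ ε₁ ε₂ a t : ℝ) (hn : 0 < n) (hΛ : 0 < Λ) (hε : 0 < ε₁)
    (p₀ p₀' : EuclideanSpace ℝ (Fin d)) (hp : ‖p₀ - p₀'‖ ≤ 2 / (n * Λ))
    (test : Fin m → EuclideanSpace ℝ (Fin d) × ℝ)
    (S : Set (Option (EuclideanSpace ℝ (Fin d)))) (hS : MeasurableSet S) :
    logRegTest n Λ ε₁ ε₂ a t p₀ test S ≤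
      ENNReal.ofReal (Real.exp ε₁) * logRegTest n Λ ε₁ ε₂ a t p₀' test S := by
  rw [aux_apply _ _ _ _ _ _ _ _ _ hS, aux_apply _ _ _ _ _ _ _ _ _ hS]
  haveI : SFinite (laplace (a / ε₂)) := by unfold laplace; infer_instance
  set g : EuclideanSpace ℝ (Fin d) → ℝ≥0∞ := fun q => laplace (a / ε₂)
    {r : ℝ | (if errS (p₀' + q) test + r ≤ t then some (p₀' + q) else none) ∈ S} with hg
  have hgm : Measurable g :=
    measurable_measure_prodMk_left (aux_meas_some t p₀' test hS)
  have e : ∀ q, laplace (a / ε₂)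
      {r : ℝ | (if errS (p₀ + q) test + r ≤ t then some (p₀ + q) else none) ∈ S}
      = g (q + (p₀ - p₀')) := by
    intro q
    have : p₀' + (q + (p₀ - p₀')) = p₀ + q := by abel
    simp only [hg, this]
  rw [lintegral_congr e, ← lintegral_map (g := fun q => q + (p₀ - p₀')) hgm (by fun_prop)]
  refine (lintegral_mono' (aux_pert_shift n Λ ε₁ hn hΛ hε _ hp) le_rfl).trans ?_
  rw [lintegral_smul_measure, smul_eq_mul]

lemma aux_softplus_convex : ConvexOn ℝ Set.univ (fun z : ℝ => Real.log (1 + Real.exp z)) := by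
  have hd : ∀ z : ℝ, HasDerivAt (fun z : ℝ => Real.log (1 + Real.exp z))
      (Real.exp z / (1 + Real.exp z)) z := fun z =>
    ((Real.hasDerivAt_exp z).const_add 1).log (by positivity)
  refine Monotone.convexOn_univ_of_deriv (fun z => (hd z).differentiableAt) ?_
  intro x y hxy
  rw [(hd x).deriv, (hd y).deriv, div_le_div_iff₀ (by positivity) (by positivity)]
  have := Real.exp_le_exp.2 hxy
  nlinarith

lemma aux_softplus_lip (x y : ℝ) :
    Real.log (1 + Real.exp x) - Real.log (1 + Real.exp y) ≤ |x - y| := by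
  have h : Real.log (1 + Real.exp x) ≤ Real.log (Real.exp (|x - y|) * (1 + Real.exp y)) := by
    refine Real.log_le_log (by positivity) ?_
    have h1 : 1 ≤ Real.exp (|x - y|) := Real.one_le_exp (abs_nonneg _)
    have h2 : Real.exp x ≤ Real.exp (|x - y|) * Real.exp y := by
      rw [← Real.exp_add]
      exact Real.exp_le_exp.2 (by linarith [le_abs_self (x - y)])
    nlinarith
  rw [Real.log_mul (by positivity) (by positivity), Real.log_exp] at h
  linarith

/-- The loss of one record. -/
noncomputable def auxLoss {d : ℕ} (r : EuclideanSpace ℝ (Fin d) × ℝ)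
    (p : EuclideanSpace ℝ (Fin d)) : ℝ :=
  Real.log (1 + Real.exp (-(r.2 * (inner ℝ p r.1 : ℝ))))

lemma auxLoss_convex {d : ℕ} (r : EuclideanSpace ℝ (Fin d) × ℝ)
    (p q : EuclideanSpace ℝ (Fin d)) (s : ℝ) (h0 : 0 ≤ s) (h1 : s ≤ 1) :
    auxLoss r ((1 - s) • p + s • q) ≤ (1 - s) * auxLoss r p + s * auxLoss r q := by
  unfold auxLoss
  have h := aux_softplus_convex.2 (Set.mem_univ (-(r.2 * (inner ℝ p r.1 : ℝ))))
    (Set.mem_univ (-(r.2 * (inner ℝ q r.1 : ℝ)))) (sub_nonneg.2 h1) h0 (by ring)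
  simp only [smul_eq_mul] at h
  have e : -(r.2 * (inner ℝ ((1 - s) • p + s • q) r.1 : ℝ)) =
      (1 - s) * -(r.2 * (inner ℝ p r.1 : ℝ)) + s * -(r.2 * (inner ℝ q r.1 : ℝ)) := by
    rw [inner_add_left, real_inner_smul_left, real_inner_smul_left]
    ring
  rw [e]
  exact h

lemma auxLoss_lip {d : ℕ} (r : EuclideanSpace ℝ (Fin d) × ℝ) (hx : ‖r.1‖ ≤ 1) (hy : |r.2| ≤ 1)
    (p q : EuclideanSpace ℝ (Fin d)) :
    auxLoss r p - auxLoss r q ≤ ‖p - q‖ := by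
  refine (aux_softplus_lip _ _).trans ?_
  have e : -(r.2 * (inner ℝ p r.1 : ℝ)) - -(r.2 * (inner ℝ q r.1 : ℝ))
    = -(r.2 * (inner ℝ (p - q) r.1 : ℝ)) := by rw [inner_sub_left]; ring
  rw [e, abs_neg, abs_mul]
  have h := abs_real_inner_le_norm (p - q) r.1
  have h2 : |(inner ℝ (p - q) r.1 : ℝ)| ≤ ‖p - q‖ := by
    nlinarith [norm_nonneg (p - q)]
  nlinarith [abs_nonneg (inner ℝ (p - q) r.1 : ℝ)]

lemma aux_growth {d n : ℕ} (Λ : ℝ) (hΛ : 0 < Λ)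
    (data : Fin n → EuclideanSpace ℝ (Fin d) × ℝ) (p q : EuclideanSpace ℝ (Fin d))
    (hp : ∀ q, logRegObjective Λ data p ≤ logRegObjective Λ data q) :
    Λ / 2 * ‖p - q‖ ^ 2 ≤ logRegObjective Λ data q - logRegObjective Λ data p := by
  have key : ∀ s : ℝ, 0 < s → s ≤ 1 → Λ / 2 * (1 - s) * ‖p - q‖ ^ 2 ≤
      logRegObjective Λ data q - logRegObjective Λ data p := by
    intro s hs0 hs1
    have h := hp ((1 - s) • p + s • q)
    have hsum : (1 / (n : ℝ)) * ∑ i, auxLoss (data i) ((1 - s) • p + s • q) ≤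
        (1 - s) * ((1 / (n : ℝ)) * ∑ i, auxLoss (data i) p)
        + s * ((1 / (n : ℝ)) * ∑ i, auxLoss (data i) q) := by
      have : ∑ i, auxLoss (data i) ((1 - s) • p + s • q) ≤
          (1 - s) * ∑ i, auxLoss (data i) p + s * ∑ i, auxLoss (data i) q := by
        rw [Finset.mul_sum, Finset.mul_sum, ← Finset.sum_add_distrib]
        exact Finset.sum_le_sum fun i _ => auxLoss_convex _ _ _ _ hs0.le hs1
      calc _ ≤ (1 / (n : ℝ)) * ((1 - s) * ∑ i, auxLoss (data i) p
            + s * ∑ i, auxLoss (data i) q) := by gcongr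
        _ = _ := by ring
    have hnorm : ‖(1 - s) • p + s • q‖ ^ 2 =
        (1 - s) * ‖p‖ ^ 2 + s * ‖q‖ ^ 2 - s * (1 - s) * ‖p - q‖ ^ 2 := by
      rw [norm_add_sq_real, norm_sub_sq_real, real_inner_smul_left, real_inner_smul_right,
        norm_smul, norm_smul, mul_pow, mul_pow, Real.norm_eq_abs, Real.norm_eq_abs, sq_abs, sq_abs]
      ring
    have ho : ∀ p, logRegObjective Λ data p =
      (1 / (n : ℝ)) * ∑ i, auxLoss (data i) p + Λ * (‖p‖ ^ 2 / 2) := fun _ => rfl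
    rw [ho, ho] at h ⊢
    rw [hnorm] at h
    refine le_of_mul_le_mul_left ?_ hs0
    linarith
  have hc : Filter.Tendsto (fun s : ℝ => Λ / 2 * (1 - s) * ‖p - q‖ ^ 2)
      (nhdsWithin 0 (Set.Ioi 0)) (nhds (Λ / 2 * (1 - 0) * ‖p - q‖ ^ 2)) := by
    refine Filter.Tendsto.mono_left (Continuous.tendsto ?_ 0) nhdsWithin_le_nhds
    fun_prop
  rw [sub_zero, mul_one] at hc
  refine le_of_tendsto hc ?_
  filter_upwards [Ioc_mem_nhdsGT (show (0 : ℝ) < 1 by norm_num)] with s hs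
  exact key s hs.1 hs.2

lemma aux_sens {d n : ℕ} (hn : 0 < n) (Λ : ℝ) (hΛ : 0 < Λ)
    (train train' : Fin n → EuclideanSpace ℝ (Fin d) × ℝ)
    (htrainx : ∀ i, ‖(train i).1‖ ≤ 1) (htrainy : ∀ i, |(train i).2| ≤ 1)
    (htrainx' : ∀ i, ‖(train' i).1‖ ≤ 1) (htrainy' : ∀ i, |(train' i).2| ≤ 1)
    (j : Fin n) (hj : ∀ i, i ≠ j → train i = train' i)
    (p p' : EuclideanSpace ℝ (Fin d))
    (hp : ∀ q, logRegObjective Λ train p ≤ logRegObjective Λ train q)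
    (hp' : ∀ q, logRegObjective Λ train' p' ≤ logRegObjective Λ train' q) :
    ‖p - p'‖ ≤ 2 / (n * Λ) := by
  have hn' : (0 : ℝ) < n := by exact_mod_cast hn
  have g1 := aux_growth Λ hΛ train p p' hp
  have g2 := aux_growth Λ hΛ train' p' p hp'
  rw [norm_sub_rev] at g2
  have ho : ∀ (data : Fin n → EuclideanSpace ℝ (Fin d) × ℝ) p, logRegObjective Λ data p =
      (1 / (n : ℝ)) * (auxLoss (data j) p + ∑ i ∈ Finset.univ.erase j, auxLoss (data i) p)
        + Λ * (‖p‖ ^ 2 / 2) := by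
    intro data p
    rw [Finset.add_sum_erase _ (fun i => auxLoss (data i) p) (Finset.mem_univ j)]
    rfl
  have hs : ∀ p, ∑ i ∈ Finset.univ.erase j, auxLoss (train i) p =
      ∑ i ∈ Finset.univ.erase j, auxLoss (train' i) p := fun p =>
    Finset.sum_congr rfl fun i hi => by rw [hj i (Finset.ne_of_mem_erase hi)]
  rw [ho, ho, hs, hs] at g1
  rw [ho, ho] at g2
  have l1 := auxLoss_lip (train j) (htrainx j) (htrainy j) p' p
  have l2 := auxLoss_lip (train' j) (htrainx' j) (htrainy' j) p p'
  rw [norm_sub_rev] at l1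
  have h3 : Λ * ‖p - p'‖ ^ 2 ≤ (1 / (n : ℝ)) * (2 * ‖p - p'‖) := by
    calc _ ≤ (1 / (n : ℝ)) * ((auxLoss (train j) p' - auxLoss (train j) p)
          + (auxLoss (train' j) p - auxLoss (train' j) p')) := by linarith
      _ ≤ _ := by gcongr; linarith
  rcases (norm_nonneg (p - p')).eq_or_lt with h0 | h0
  · rw [← h0]; positivity
  · rw [le_div_iff₀ (by positivity)]
    have h4 : Λ * ‖p - p'‖ ≤ (1 / (n : ℝ)) * 2 := by
      refine le_of_mul_le_mul_right ?_ h0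
      linarith
    calc _ = n * (Λ * ‖p - p'‖) := by ring
      _ ≤ n * ((1 / (n : ℝ)) * 2) := by gcongr
      _ = 2 := by field_simp

lemma aux_sig_lip (z w : ℝ) :
    2 / (1 + Real.exp (-z)) - 2 / (1 + Real.exp (-w)) ≤ 2 * |z - w| := by
  have hA := Real.exp_pos (-z)
  have hB := Real.exp_pos (-w)
  have h1 : 1 - |z - w| ≤ Real.exp (-|z - w|) := by
    linarith [Real.add_one_le_exp (-|z - w|)]
  have h2 : Real.exp (-|z - w|) * Real.exp (-w) ≤ Real.exp (-z) := by
    rw [← Real.exp_add]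
    exact Real.exp_le_exp.2 (by linarith [le_abs_self (z - w)])
  have h3 : (1 - |z - w|) * Real.exp (-w) ≤ Real.exp (-z) :=
    (mul_le_mul_of_nonneg_right h1 hB.le).trans h2
  rw [div_sub_div _ _ (by positivity) (by positivity), div_le_iff₀ (by positivity)]
  have h4 := abs_nonneg (z - w)
  have h5 : 0 ≤ |z - w| * (1 + Real.exp (-z) + Real.exp (-z) * Real.exp (-w)) := by positivity
  nlinarith

lemma aux_hLog_lip {d : ℕ} (p p' x : EuclideanSpace ℝ (Fin d)) (hx : ‖x‖ ≤ 1) :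
    |hLog p x - hLog p' x| ≤ 2 * ‖p - p'‖ := by
  have h : |(inner ℝ p x : ℝ) - inner ℝ p' x| ≤ ‖p - p'‖ := by
    rw [← inner_sub_left]
    have := abs_real_inner_le_norm (p - p') x
    nlinarith [norm_nonneg (p - p')]
  unfold hLog
  have h1 := aux_sig_lip (inner ℝ p x) (inner ℝ p' x)
  have h2 := aux_sig_lip (inner ℝ p' x) (inner ℝ p x)
  rw [abs_sub_comm] at h2
  rw [abs_le]
  constructor <;> linarith

lemma aux_err_bound {d m : ℕ} (hm : 0 < m) (p p' : EuclideanSpace ℝ (Fin d))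
    (test : Fin m → EuclideanSpace ℝ (Fin d) × ℝ) (htestx : ∀ i, ‖(test i).1‖ ≤ 1) :
    |errS p test - errS p' test| ≤ 2 * ‖p - p'‖ := by
  have hm' : (0 : ℝ) < m := by exact_mod_cast hm
  unfold errS
  rw [← mul_sub, ← Finset.sum_sub_distrib, abs_mul, abs_of_nonneg (by positivity : 0 ≤ 1 / (m : ℝ))]
  calc _ ≤ (1 / (m : ℝ)) * ∑ i : Fin m, 2 * ‖p - p'‖ := by
        gcongr
        refine (Finset.abs_sum_le_sum_abs _ _).trans (Finset.sum_le_sum fun i _ => ?_)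
        refine (abs_abs_sub_abs_le_abs_sub _ _).trans ?_
        rw [sub_sub_sub_cancel_right]
        exact aux_hLog_lip _ _ _ (htestx i)
    _ = _ := by
        simp only [Finset.sum_const, Finset.card_univ, Fintype.card_fin, nsmul_eq_mul]
        field_simp

lemma aux_hLog_bound {d : ℕ} (p x : EuclideanSpace ℝ (Fin d)) (y : ℝ) (hy : |y| ≤ 1) :
    |hLog p x - y| ≤ 2 := by
  unfold hLog
  have hA := Real.exp_pos (-(inner ℝ p x : ℝ))
  have h1 : 0 ≤ 2 / (1 + Real.exp (-(inner ℝ p x : ℝ))) := by positivity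
  have h2 : 2 / (1 + Real.exp (-(inner ℝ p x : ℝ))) ≤ 2 := by
    rw [div_le_iff₀ (by positivity)]; linarith
  rw [abs_le] at *
  constructor <;> linarith [hy.1, hy.2]

lemma aux_err_test {d m : ℕ} (hm : 0 < m) (p : EuclideanSpace ℝ (Fin d))
    (test test' : Fin m → EuclideanSpace ℝ (Fin d) × ℝ)
    (htesty : ∀ i, |(test i).2| ≤ 1) (htesty' : ∀ i, |(test' i).2| ≤ 1)
    (j : Fin m) (hj : ∀ i, i ≠ j → test i = test' i) :
    |errS p test - errS p test'| ≤ 2 / m := by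
  have hm' : (0 : ℝ) < m := by exact_mod_cast hm
  unfold errS
  rw [← mul_sub, ← Finset.sum_sub_distrib, abs_mul, abs_of_nonneg (by positivity : 0 ≤ 1 / (m : ℝ))]
  rw [Finset.sum_eq_single j (fun i _ hi => by rw [hj i hi, sub_self]) (by simp)]
  have b1 := aux_hLog_bound p (test j).1 _ (htesty j)
  have b2 := aux_hLog_bound p (test' j).1 _ (htesty' j)
  have b3 := abs_nonneg (hLog p (test j).1 - (test j).2)
  have b4 := abs_nonneg (hLog p (test' j).1 - (test' j).2)
  have h : |(|hLog p (test j).1 - (test j).2| - |hLog p (test' j).1 - (test' j).2|)| ≤ 2 := by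
    rw [abs_le]; constructor <;> linarith
  calc _ ≤ (1 / (m : ℝ)) * 2 := by gcongr
    _ = _ := by ring

/-- with `a = max(2/n^test, 2(exp(2/(n^train Λ)) − 1))`, the mechanism
`LogRegTest` is `({ℝ^d, {⊥}}, E, 0)`-ODP with `E(ℝ^d) = max(ε₁, (2/n^test)/a · ε₂)`
and `E({⊥}) = min(E(ℝ^d), ε₂)`, w.r.t. a change of a single record in either the
training set or the test set. -/
theorem logRegTest_odp {d ntrain ntest : ℕ} (hntrain : 0 < ntrain) (hntest : 0 < ntest)
    (Λ ε₁ ε₂ t : ℝ) (hΛ : 0 < Λ) (hε₁ : 0 < ε₁) (hε₂ : 0 < ε₂)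
    (a : ℝ) (ha : a = max (2 / (ntest : ℝ))
      (2 * (Real.exp (2 / ((ntrain : ℝ) * Λ)) - 1)))
    (train train' : Fin ntrain → EuclideanSpace ℝ (Fin d) × ℝ)
    (test test' : Fin ntest → EuclideanSpace ℝ (Fin d) × ℝ)
    (htrainx : ∀ i, ‖(train i).1‖ ≤ 1) (htrainy : ∀ i, |(train i).2| ≤ 1)
    (htrainx' : ∀ i, ‖(train' i).1‖ ≤ 1) (htrainy' : ∀ i, |(train' i).2| ≤ 1)
    (htestx : ∀ i, ‖(test i).1‖ ≤ 1) (htesty : ∀ i, |(test i).2| ≤ 1)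
    (htestx' : ∀ i, ‖(test' i).1‖ ≤ 1) (htesty' : ∀ i, |(test' i).2| ≤ 1)
    (hneighbor :
      (test = test' ∧ ∃ j : Fin ntrain, ∀ i, i ≠ j → train i = train' i) ∨
      (train = train' ∧ ∃ j : Fin ntest, ∀ i, i ≠ j → test i = test' i))
    (p₀ p₀' : EuclideanSpace ℝ (Fin d))
    (hp₀ : ∀ q, logRegObjective Λ train p₀ ≤ logRegObjective Λ train q)
    (hp₀' : ∀ q, logRegObjective Λ train' p₀' ≤ logRegObjective Λ train' q)
    (hp₀eq : train = train' → p₀ = p₀')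
    (S : Set (Option (EuclideanSpace ℝ (Fin d)))) (hS : MeasurableSet S) :
    logRegTest ntrain Λ ε₁ ε₂ a t p₀ test S ≤
      ENNReal.ofReal (Real.exp (max ε₁ ((2 / (ntest : ℝ)) / a * ε₂))) *
        logRegTest ntrain Λ ε₁ ε₂ a t p₀' test' (S ∩ {o | o ≠ none}) +
      ENNReal.ofReal (Real.exp (min (max ε₁ ((2 / (ntest : ℝ)) / a * ε₂)) ε₂)) *
        logRegTest ntrain Λ ε₁ ε₂ a t p₀' test' (S ∩ {none}) := by
  have hn' : (0 : ℝ) < ntrain := by exact_mod_cast hntrain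
  have hm' : (0 : ℝ) < ntest := by exact_mod_cast hntest
  have ha1 : 2 / (ntest : ℝ) ≤ a := ha ▸ le_max_left _ _
  have ha2 : 2 * (2 / ((ntrain : ℝ) * Λ)) ≤ a := by
    refine le_trans ?_ (ha ▸ le_max_right _ _)
    linarith [Real.add_one_le_exp (2 / ((ntrain : ℝ) * Λ))]
  have ha0 : 0 < a := lt_of_lt_of_le (by positivity) ha1
  have hc : (2 / (ntest : ℝ)) / a * ε₂ ≤ ε₂ := by
    have : (2 / (ntest : ℝ)) / a ≤ 1 := (div_le_one ha0).2 ha1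
    nlinarith
  have mono : ∀ x y : ℝ, x ≤ y → ENNReal.ofReal (Real.exp x) ≤ ENNReal.ofReal (Real.exp y) :=
    fun x y h => ENNReal.ofReal_le_ofReal (Real.exp_le_exp.2 h)
  have hnone : MeasurableSet ({none} : Set (Option (EuclideanSpace ℝ (Fin d)))) := by
    change MeasurableSet (some ⁻¹' {none} : Set (EuclideanSpace ℝ (Fin d)))
    have : (some ⁻¹' {none} : Set (EuclideanSpace ℝ (Fin d))) = ∅ := by ext; simp
    rw [this]; exact MeasurableSet.empty
  have hS1 : MeasurableSet (S ∩ {o | o ≠ none}) := hS.inter hnone.compl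
  have hS2 : MeasurableSet (S ∩ {none}) := hS.inter hnone
  have hsplit : S = (S ∩ {o | o ≠ none}) ∪ (S ∩ {none}) := by
    ext o; by_cases h : o = none <;> simp [h]
  have step : logRegTest ntrain Λ ε₁ ε₂ a t p₀ test S ≤
      logRegTest ntrain Λ ε₁ ε₂ a t p₀ test (S ∩ {o | o ≠ none}) +
      logRegTest ntrain Λ ε₁ ε₂ a t p₀ test (S ∩ {none}) := by
    conv_lhs => rw [hsplit]
    exact measure_union_le _ _
  refine step.trans ?_
  rcases hneighbor with ⟨rfl, j, hj⟩ | ⟨htr, j, hj⟩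
  · have hD := aux_sens hntrain Λ hΛ train train' htrainx htrainy htrainx' htrainy' j hj
      p₀ p₀' hp₀ hp₀'
    have hpar := aux_param (d := d) ntrain Λ ε₁ ε₂ a t hntrain hΛ hε₁ p₀ p₀' hD test
    refine add_le_add ?_ ?_
    · exact (hpar _ hS1).trans (mul_le_mul_left (mono _ _ (le_max_left _ _)) _)
    · rcases le_total (max ε₁ ((2 / (ntest : ℝ)) / a * ε₂)) ε₂ with h | h
      · rw [min_eq_left h]
        exact (hpar _ hS2).trans (mul_le_mul_left (mono _ _ (le_max_left _ _)) _)
      · rw [min_eq_right h]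
        have hs := aux_score ntrain Λ ε₁ ε₂ a t a ha0 hε₂ p₀ p₀' test test _ hS2
          (Or.inr fun p => by simp) (fun q => by
            refine (aux_err_bound hntest _ _ test htestx).trans (le_trans ?_ ha2)
            rw [add_sub_add_right_eq_sub]
            linarith)
        rwa [div_self ha0.ne', one_mul] at hs
  · obtain rfl := hp₀eq htr
    have hs := fun T hT => aux_score ntrain Λ ε₁ ε₂ a t (2 / (ntest : ℝ)) ha0 hε₂ p₀ p₀ test test' T hT
      (Or.inl rfl) (fun q => aux_err_test hntest _ test test' htesty htesty' j hj)
    refine add_le_add ?_ ?_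
    · exact (hs _ hS1).trans (mul_le_mul_left (mono _ _ (le_max_right _ _)) _)
    · exact (hs _ hS2).trans (mul_le_mul_left (mono _ _ (le_min (le_max_right _ _) hc)) _)
end
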